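/- For all n ≥ 1, the number of collapsed permutations of {1,…,2n+2} equals the number of permutations in G^I_{2n}; that is, |𝒞𝒪_{2n+2}| = |G^I_{2n}|. -/

import Mathlib

/-- A permutation `π` of `{1, …, 2m}` is collapsed if
`1 + ⌊k/2⌋ ≤ π⁻¹(k) ≤ m + ⌊k/2⌋` for every `k ∈ {1, …, 2m}`
(positions and values are 1-indexed: the value `k` corresponds to the
index `⟨k-1, _⟩`, and the position of `k` is `(π.symm ⟨k-1, _⟩ : ℕ) + 1`). -/
def IsCollapsed (m : ℕ) (π : Equiv.Perm (Fin (2 * m))) : Prop :=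
  ∀ k : Fin (2 * m),
    1 + ((k : ℕ) + 1) / 2 ≤ (π.symm k : ℕ) + 1 ∧
    (π.symm k : ℕ) + 1 ≤ m + ((k : ℕ) + 1) / 2

/-- A permutation of `{1, …, m}` (one-line notation `π_1 ⋯ π_m`, where the
entry at position `i+1` is `(π i : ℕ) + 1`) belongs to `G^I` if every ascent
is odd–even: whenever `π_i < π_{i+1}`, the entry `π_i` is odd and `π_{i+1}` is even. -/
def IsGI {m : ℕ} (π : Equiv.Perm (Fin m)) : Prop :=
  ∀ i j : Fin m, (i : ℕ) + 1 = (j : ℕ) → π i < π j →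
    Odd ((π i : ℕ) + 1) ∧ Even ((π j : ℕ) + 1)

open Classical in
theorem card_prod_aux {α β : Type} [Fintype α] [Fintype β] (P : α → β → Prop) :
    Nat.card {x : α × β // P x.1 x.2} = ∑ a, Nat.card {b // P a b} := by
  rw [Nat.card_congr (Equiv.subtypeProdEquivSigmaSubtype P), Nat.card_sigma]

/-- Hamiltonian path condition. -/
def HChain {N : ℕ} (A : Fin N → Fin N → Prop) (π : Equiv.Perm (Fin N)) : Prop :=
  ∀ i j : Fin N, (i : ℕ) + 1 = (j : ℕ) → A (π i) (π j)

/-- Contraction of the relation. -/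
def contr {N : ℕ} (A : Fin (N+1) → Fin (N+1) → Prop) (p : Fin (N+1)) (i j : Fin N) : Prop :=
  j.succ = p ∨ A i.succ j.succ

theorem cover_iff {N : ℕ} (A : Fin (N+1) → Fin (N+1) → Prop) (hA : ∀ i j, j ≤ i → A i j)
    (p : Fin (N+1)) (e : Equiv.Perm (Fin N)) :
    (∀ i, A i (Equiv.Perm.decomposeFin.symm (p, e) i)) ↔
      (A 0 p ∧ ∀ i, contr A p i (e i)) := by
  rw [Fin.forall_fin_succ]
  simp only [Equiv.Perm.decomposeFin_symm_apply_zero, Equiv.Perm.decomposeFin_symm_apply_succ]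
  refine and_congr_right fun _ => forall_congr' fun i => ?_
  unfold contr
  by_cases h : (e i).succ = p
  · subst h
    simp [hA]
  · rw [Equiv.swap_apply_of_ne_of_ne (Fin.succ_ne_zero _) h]
    simp [h]

/-- Position where `0` gets inserted. -/
def insPos {N : ℕ} (p : Fin (N+1)) (e : Equiv.Perm (Fin N)) : Fin (N+1) :=
  Fin.cases (Fin.last N) (fun j => (e.symm j).castSucc) p

/-- Insert `0` in a word at a given position. -/
def insPerm {N : ℕ} (q : Fin (N+1)) (e : Equiv.Perm (Fin N)) : Equiv.Perm (Fin (N+1)) :=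
  ((finSuccEquiv' q).trans (Equiv.optionCongr e)).trans (finSuccEquiv' 0).symm

theorem insPerm_at {N : ℕ} (q : Fin (N+1)) (e : Equiv.Perm (Fin N)) : insPerm q e q = 0 := by
  simp [insPerm]

theorem insPerm_succAbove {N : ℕ} (q : Fin (N+1)) (e : Equiv.Perm (Fin N)) (i : Fin N) :
    insPerm q e (q.succAbove i) = (e i).succ := by
  simp [insPerm]

theorem ins_bij (N : ℕ) : Function.Bijective
    (fun x : Fin (N+1) × Equiv.Perm (Fin N) => insPerm (insPos x.1 x.2) x.2) := by
  rw [Fintype.bijective_iff_injective_and_card]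
  constructor
  · rintro ⟨p, e⟩ ⟨p', e'⟩ h
    simp only at h
    have hq : insPos p e = insPos p' e' := by
      apply (insPerm (insPos p e) e).injective
      rw [insPerm_at, h, insPerm_at]
    have he : e = e' := by
      ext i : 1
      have := insPerm_succAbove (insPos p e) e i
      rw [h, hq, insPerm_succAbove] at this
      exact (Fin.succ_injective _ this).symm
    subst he
    have : p = p' := by
      revert hq
      refine Fin.cases ?_ (fun j => ?_) p <;> refine Fin.cases ?_ (fun j' => ?_) p'
      · simp
      · intro h
        simp only [insPos, Fin.cases_zero, Fin.cases_succ] at h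
        exact absurd h.symm (Fin.castSucc_lt_last _).ne
      · intro h
        simp only [insPos, Fin.cases_zero, Fin.cases_succ] at h
        exact absurd h (Fin.castSucc_lt_last _).ne
      · intro h
        simp only [insPos, Fin.cases_succ] at h
        simpa using h
    rw [this]
  · simp [Fintype.card_perm, Nat.factorial_succ]

theorem chain_iff {N : ℕ} (A : Fin (N+1) → Fin (N+1) → Prop) (hA : ∀ i j, j ≤ i → A i j)
    (p : Fin (N+1)) (e : Equiv.Perm (Fin N)) :
    HChain A (insPerm (insPos p e) e) ↔ (A 0 p ∧ HChain (contr A p) e) := by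
  have hat := insPerm_at (insPos p e) e
  have hsa := insPerm_succAbove (insPos p e) e
  generalize insPerm (insPos p e) e = π at hat hsa
  revert hat hsa
  refine Fin.cases ?_ (fun k => ?_) p
  · simp only [insPos, Fin.cases_zero, Fin.succAbove_last]
    intro hat hsa
    constructor
    · intro h
      refine ⟨hA _ _ le_rfl, fun i j hij => Or.inr ?_⟩
      rw [← hsa, ← hsa]
      exact h _ _ (by simpa using hij)
    · rintro ⟨-, h⟩ i j hij
      induction j using Fin.lastCases with
      | last => rw [hat]; exact hA _ _ (Fin.zero_le _)
      | cast j =>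
        induction i using Fin.lastCases with
        | last => simp at hij; omega
        | cast i =>
          rw [hsa, hsa]
          rcases h i j (by simpa using hij) with h | h
          · exact absurd h (Fin.succ_ne_zero _)
          · exact h
  · simp only [insPos, Fin.cases_succ]
    obtain ⟨q, rfl⟩ := e.surjective k
    rw [Equiv.symm_apply_apply]
    intro hat hsa
    have h1 : ∀ i : Fin N, i < q → π i.castSucc = (e i).succ := fun i hi => by
      rw [← hsa, Fin.succAbove_of_castSucc_lt]; simpa using hi
    have h2 : ∀ i : Fin N, q ≤ i → π i.succ = (e i).succ := fun i hi => by
      rw [← hsa, Fin.succAbove_of_le_castSucc]; simpa using hi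
    constructor
    · intro h
      refine ⟨?_, fun i j hij => ?_⟩
      · have := h q.castSucc q.succ (by simp)
        rwa [hat, h2 q le_rfl] at this
      · unfold contr
        rcases lt_trichotomy j q with hj | hj | hj
        · right
          rw [← h1 j hj, ← h1 i (by rw [Fin.lt_def] at *; omega)]
          exact h _ _ (by simpa using hij)
        · left; rw [hj]
        · right
          rw [← h2 j hj.le, ← h2 i (by rw [Fin.lt_def] at *; rw [Fin.le_def]; omega)]
          exact h _ _ (by simpa using hij)
    · rintro ⟨h0, h⟩ i j hij
      rcases lt_trichotomy (j : ℕ) (q : ℕ) with hj | hj | hj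
      · have hi' : (i : ℕ) < N := by omega
        have hj' : (j : ℕ) < N := by omega
        have e1 := h1 ⟨i, hi'⟩ (by rw [Fin.lt_def]; simp; omega)
        have e2 := h1 ⟨j, hj'⟩ (by rw [Fin.lt_def]; simpa using hj)
        simp only [Fin.castSucc_mk, Fin.eta] at e1 e2
        rw [e1, e2]
        rcases h ⟨i, hi'⟩ ⟨j, hj'⟩ hij with h | h
        · have := e.injective (Fin.succ_injective _ h)
          rw [← this] at hj
          simp at hj
        · exact h
      · have : j = q.castSucc := Fin.ext hj
        rw [this, hat]; exact hA _ _ (Fin.zero_le _)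
      · obtain ⟨j', rfl⟩ : ∃ j' : Fin N, j = j'.succ :=
          ⟨⟨j - 1, by omega⟩, by ext; simp; omega⟩
        rw [h2 j' (by rw [Fin.le_def]; simp at hj; omega)]
        by_cases hi : (i : ℕ) = q
        · have : i = q.castSucc := Fin.ext hi
          have hj2 : j' = q := by ext; simp at hij; omega
          rw [this, hat, hj2]
          exact h0
        · obtain ⟨i', rfl⟩ : ∃ i' : Fin N, i = i'.succ :=
            ⟨⟨i - 1, by omega⟩, by ext; simp; omega⟩
          simp at hij hj hi
          rw [h2 i' (by rw [Fin.le_def]; omega)]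
          rcases h i' j' (by omega) with h | h
          · have := e.injective (Fin.succ_injective _ h)
            rw [← this] at hi
            omega
          · exact h

theorem foata (N : ℕ) : ∀ (A : Fin N → Fin N → Prop), (∀ i j, j ≤ i → A i j) →
    Nat.card {π : Equiv.Perm (Fin N) // HChain A π} =
      Nat.card {σ : Equiv.Perm (Fin N) // ∀ i, A i (σ i)} := by
  induction N with
  | zero =>
    intro A _
    apply Nat.card_congr
    exact Equiv.subtypeEquivRight fun π => ⟨fun _ i => i.elim0, fun _ i => i.elim0⟩
  | succ N ih =>
    intro A hA
    have E1 : {x : Fin (N+1) × Equiv.Perm (Fin N) // A 0 x.1 ∧ HChain (contr A x.1) x.2} ≃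
        {π : Equiv.Perm (Fin (N+1)) // HChain A π} :=
      (Equiv.ofBijective _ (ins_bij N)).subtypeEquiv
        fun x => (chain_iff A hA x.1 x.2).symm
    have E2 : {x : Fin (N+1) × Equiv.Perm (Fin N) // A 0 x.1 ∧ ∀ i, contr A x.1 i (x.2 i)} ≃
        {σ : Equiv.Perm (Fin (N+1)) // ∀ i, A i (σ i)} :=
      (Equiv.Perm.decomposeFin.symm).subtypeEquiv
        fun x => (cover_iff A hA x.1 x.2).symm
    rw [← Nat.card_congr E1, ← Nat.card_congr E2,
      card_prod_aux (fun p e => A 0 p ∧ HChain (contr A p) e),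
      card_prod_aux (fun p (e : Equiv.Perm (Fin N)) => A 0 p ∧ ∀ i, contr A p i (e i))]
    refine Finset.sum_congr rfl fun p _ => ?_
    by_cases h : A 0 p
    · simp only [h, true_and]
      apply ih
      intro i j hij
      exact Or.inr (hA _ _ (by simpa using hij))
    · simp [h]

/-- Hybrid relation. -/
def TT (t i j : ℕ) : Prop :=
  i / 2 = j / 2 ∨ (j / 2 < i / 2 ∧ (j % 2 = 0 ∨ j / 2 < t)) ∨
    (i / 2 < j / 2 ∧ j % 2 = 1 ∧ (i % 2 = 0 ∨ t ≤ i / 2))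

theorem cross_eq {N : ℕ} (d : Fin N) (τ : Equiv.Perm (Fin N)) (h : τ d = d) :
    Nat.card {i : Fin N // i < d ∧ d < τ i} = Nat.card {i : Fin N // d < i ∧ τ i < d} := by
  classical
  simp only [Nat.card_eq_fintype_card, Fintype.card_subtype]
  have hne : ∀ i, i ≠ d → τ i ≠ d := fun i hi h' => hi (τ.injective (h'.trans h.symm))
  have a1 : (Finset.univ.filter fun i : Fin N => i < d).card =
      (Finset.univ.filter fun i : Fin N => τ i < d).card := by
    symm
    apply Finset.card_bij (fun i _ => τ i)
    · intro a ha; simpa using ha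
    · intro a _ b _ hab; exact τ.injective hab
    · intro b hb; exact ⟨τ.symm b, by simpa using hb, by simp⟩
  have a2 := Finset.card_filter_add_card_filter_not (s := Finset.univ.filter fun i : Fin N => i < d)
    (fun i => τ i < d)
  have a3 := Finset.card_filter_add_card_filter_not
    (s := Finset.univ.filter fun i : Fin N => τ i < d) (fun i => i < d)
  simp only [Finset.filter_filter] at a2 a3
  have b1 : (Finset.univ.filter fun i : Fin N => i < d ∧ ¬ τ i < d) =
      Finset.univ.filter fun i : Fin N => i < d ∧ d < τ i := by
    ext i; simp only [Finset.mem_filter, Finset.mem_univ, true_and]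
    constructor
    · rintro ⟨h1, h2⟩
      exact ⟨h1, lt_of_le_of_ne (not_lt.1 h2) (hne i h1.ne).symm⟩
    · rintro ⟨h1, h2⟩; exact ⟨h1, h2.not_gt⟩
  have b2 : (Finset.univ.filter fun i : Fin N => τ i < d ∧ ¬ i < d) =
      Finset.univ.filter fun i : Fin N => d < i ∧ τ i < d := by
    ext i; simp only [Finset.mem_filter, Finset.mem_univ, true_and]
    constructor
    · rintro ⟨h1, h2⟩
      refine ⟨lt_of_le_of_ne (not_lt.1 h2) ?_, h1⟩
      rintro rfl
      rw [h] at h1; exact lt_irrefl _ h1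
    · rintro ⟨h1, h2⟩; exact ⟨h2, h1.not_gt⟩
  have b3 : (Finset.univ.filter fun i : Fin N => τ i < d ∧ i < d) =
      Finset.univ.filter fun i : Fin N => i < d ∧ τ i < d := by
    ext i; simp [and_comm]
  rw [b1] at a2
  rw [b2, b3] at a3
  omega

/-- Cutting the point `d` out of a permutation. -/
theorem cut_card {N : ℕ} (d : Fin N) (Good : Equiv.Perm (Fin N) → Prop)
    (C : Fin N → Fin N → Prop) (hC : ∀ i j, C i j → i ≠ d ∧ j ≠ d)
    (S : Equiv.Perm (Fin N) → Prop)
    (hS : ∀ τ i, τ d = d → i ≠ d → (S (τ * Equiv.swap i d) ↔ Good τ ∧ C i (τ i)))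
    (hS0 : ∀ σ, S σ → σ d ≠ d) :
    Nat.card {σ // S σ} =
      ∑ τ : Equiv.Perm (Fin N), Nat.card {i // (τ d = d ∧ Good τ) ∧ C i (τ i)} := by
  rw [← card_prod_aux (fun (τ : Equiv.Perm (Fin N)) i => (τ d = d ∧ Good τ) ∧ C i (τ i))]
  have key : ∀ σ : Equiv.Perm (Fin N), (σ * Equiv.swap (σ.symm d) d) d = d := by
    intro σ; simp
  have key2 : ∀ σ : Equiv.Perm (Fin N), S σ → σ.symm d ≠ d := by
    intro σ h h'
    apply hS0 σ h
    rw [Equiv.symm_apply_eq] at h'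
    exact h'.symm
  apply Nat.card_congr
  refine ⟨fun σ => ⟨(σ.1 * Equiv.swap (σ.1.symm d) d, σ.1.symm d), ?_⟩,
    fun x => ⟨x.1.1 * Equiv.swap x.1.2 d, ?_⟩, ?_, ?_⟩
  · have := (hS (σ.1 * Equiv.swap (σ.1.symm d) d) (σ.1.symm d) (key _) (key2 _ σ.2)).1
      (by rw [mul_assoc, Equiv.swap_mul_self, mul_one]; exact σ.2)
    exact ⟨⟨key _, this.1⟩, this.2⟩
  · exact (hS _ _ x.2.1.1 (hC _ _ x.2.2).1).2 ⟨x.2.1.2, x.2.2⟩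
  · rintro ⟨σ, h⟩
    simp [mul_assoc]
  · rintro ⟨⟨τ, i⟩, ⟨h1, h2⟩, h3⟩
    have hi : (τ * Equiv.swap i d).symm d = i := by
      rw [Equiv.symm_apply_eq]; simp [h1]
    simp only [Subtype.mk.injEq, Prod.mk.injEq]
    rw [hi]
    simp [mul_assoc]

theorem card_split {α : Type} [Finite α] (P Q : α → Prop) :
    Nat.card {a // P a} = Nat.card {a // P a ∧ Q a} + Nat.card {a // P a ∧ ¬ Q a} := by
  classical
  have := Fintype.ofFinite α
  simp only [Nat.card_eq_fintype_card, Fintype.card_subtype]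
  have := Finset.card_filter_add_card_filter_not (s := Finset.univ.filter P) Q
  simp only [Finset.filter_filter] at this
  exact this.symm

theorem hyb_aux {N : ℕ} (t : ℕ) (d : Fin N) (hd : (d : ℕ) = 2 * t + 1) (s : ℕ) (hs : s = t ∨ s = t + 1)
    (τ : Equiv.Perm (Fin N)) (i : Fin N) (h : τ d = d) (hi : i ≠ d) :
    (∀ k : Fin N, TT s k ((τ * Equiv.swap i d) k)) ↔
      TT s i d ∧ TT s d (τ i) ∧ ∀ k : Fin N, k ≠ i → k ≠ d → TT t k (τ k) := by
  have hv : ∀ k : Fin N, k ≠ d → (k : ℕ) ≠ 2 * t + 1 := fun k hk h' => hk (Fin.ext (h'.trans hd.symm))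
  have r0 : ∀ i j : ℕ, i ≠ 2*t+1 → j ≠ 2*t+1 → (TT s i j ↔ TT t i j) := by
    intro i j hi hj; unfold TT; omega
  have ot : ∀ k : Fin N, k ≠ i → k ≠ d → (TT s k ((τ * Equiv.swap i d) k) ↔ TT t k (τ k)) := by
    intro k h1 h2
    rw [Equiv.Perm.mul_apply, Equiv.swap_apply_of_ne_of_ne h1 h2]
    apply r0 _ _ (hv k h2)
    apply hv
    intro h'
    exact h2 (τ.injective (h'.trans h.symm))
  constructor
  · intro H
    have H1 := H i
    have H2 := H d
    simp only [Equiv.Perm.mul_apply, Equiv.swap_apply_left, Equiv.swap_apply_right, h] at H1 H2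
    exact ⟨H1, H2, fun k h1 h2 => (ot k h1 h2).1 (H k)⟩
  · rintro ⟨H1, H2, H3⟩ k
    by_cases h1 : k = i
    · subst h1; simpa [h] using H1
    by_cases h2 : k = d
    · subst h2; simpa using H2
    exact (ot k h1 h2).2 (H3 k h1 h2)

theorem hyb_aux2 {N : ℕ} (t : ℕ) (d : Fin N) 
    (τ : Equiv.Perm (Fin N)) (i : Fin N) (h : τ d = d) :
    (∀ k : Fin N, TT t k (τ k)) ↔
      TT t i (τ i) ∧ ∀ k : Fin N, k ≠ i → k ≠ d → TT t k (τ k) := by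
  constructor
  · intro H
    exact ⟨H i, fun k _ _ => H k⟩
  · rintro ⟨H1, H3⟩ k
    by_cases h1 : k = i
    · subst h1; exact H1
    by_cases h2 : k = d
    · subst h2; rw [h]; exact Or.inl rfl
    exact H3 k h1 h2

theorem hybrid (n t : ℕ) (ht : t < n) :
    Nat.card {σ : Equiv.Perm (Fin (2 * n)) // ∀ i : Fin (2 * n), TT t i (σ i)} =
    Nat.card {σ : Equiv.Perm (Fin (2 * n)) // ∀ i : Fin (2 * n), TT (t+1) i (σ i)} := by
  rw [card_split (fun σ : Equiv.Perm (Fin (2 * n)) => ∀ i : Fin (2 * n), TT t i (σ i))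
      (fun σ => ∀ i : Fin (2 * n), TT (t+1) i (σ i)),
    card_split (fun σ : Equiv.Perm (Fin (2 * n)) => ∀ i : Fin (2 * n), TT (t+1) i (σ i))
      (fun σ => ∀ i : Fin (2 * n), TT t i (σ i))]
  congr 1
  · simp only [and_comm]
  obtain ⟨d, hdv⟩ : ∃ d : Fin (2 * n), (d : ℕ) = 2 * t + 1 := ⟨⟨2 * t + 1, by omega⟩, rfl⟩
  have hv : ∀ k : Fin (2*n), k ≠ d → (k : ℕ) ≠ 2 * t + 1 :=
    fun k hk h' => hk (Fin.ext (h'.trans hdv.symm))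
  have r0 : ∀ i j : ℕ, i ≠ 2*t+1 → j ≠ 2*t+1 → (TT t i j ↔ TT (t+1) i j) := by
    intro i j hi hj; unfold TT; omega
  have fixd : ∀ σ : Equiv.Perm (Fin (2*n)), σ d = d →
      ((∀ i : Fin (2 * n), TT t i (σ i)) ↔ ∀ i : Fin (2 * n), TT (t+1) i (σ i)) := by
    intro σ h
    refine forall_congr' fun k => ?_
    by_cases h2 : k = d
    · subst h2; rw [h]; exact ⟨fun _ => Or.inl rfl, fun _ => Or.inl rfl⟩
    · exact r0 _ _ (hv _ h2) (hv _ fun h' => h2 (σ.injective (h'.trans h.symm)))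
  rw [cut_card d (fun τ => ∀ i : Fin (2 * n), TT t i (τ i)) (fun i j => i < d ∧ d < j) ?_ _ ?_ ?_,
    cut_card d (fun τ => ∀ i : Fin (2 * n), TT t i (τ i)) (fun i j => d < i ∧ j < d) ?_ _ ?_ ?_]
  · refine Finset.sum_congr rfl fun τ _ => ?_
    by_cases h : τ d = d ∧ ∀ i : Fin (2 * n), TT t i (τ i)
    · simp only [eq_true h, true_and]
      exact cross_eq d τ h.1
    · simp only [h, false_and]
  · rintro i j ⟨h1, h2⟩; exact ⟨h1.ne', h2.ne⟩
  · intro τ i h hi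
    rw [hyb_aux t d hdv t (Or.inl rfl) τ i h hi, hyb_aux t d hdv (t+1) (Or.inr rfl) τ i h hi,
      hyb_aux2 t d τ i h]
    have h1 := hv i hi
    have h2 := hv (τ i) fun h' => hi (τ.injective (h'.trans h.symm))
    by_cases X : ∀ k : Fin (2*n), k ≠ i → k ≠ d → TT t k (τ k)
    · simp only [eq_true X, and_true, Fin.lt_def, hdv]
      unfold TT
      omega
    · simp [X]
  · rintro σ ⟨h1, h2⟩ h
    exact h2 ((fixd σ h).2 h1)
  · rintro i j ⟨h1, h2⟩; exact ⟨h1.ne, h2.ne'⟩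
  · intro τ i h hi
    rw [hyb_aux t d hdv t (Or.inl rfl) τ i h hi, hyb_aux t d hdv (t+1) (Or.inr rfl) τ i h hi,
      hyb_aux2 t d τ i h]
    have h1 := hv i hi
    have h2 := hv (τ i) fun h' => hi (τ.injective (h'.trans h.symm))
    by_cases X : ∀ k : Fin (2*n), k ≠ i → k ≠ d → TT t k (τ k)
    · simp only [eq_true X, and_true, Fin.lt_def, hdv]
      unfold TT
      omega
    · simp [X]
  · rintro σ ⟨h1, h2⟩ h
    exact h2 ((fixd σ h).1 h1)

theorem hybrid_all (n t : ℕ) (ht : t ≤ n) :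
    Nat.card {σ : Equiv.Perm (Fin (2 * n)) // ∀ i : Fin (2 * n), TT 0 i (σ i)} =
    Nat.card {σ : Equiv.Perm (Fin (2 * n)) // ∀ i : Fin (2 * n), TT t i (σ i)} := by
  induction t with
  | zero => rfl
  | succ t ih => rw [ih (by omega), hybrid n t (by omega)]

theorem gi_card (n : ℕ) : Nat.card {π : Equiv.Perm (Fin (2 * n)) // IsGI π} =
    Nat.card {σ : Equiv.Perm (Fin (2 * n)) // ∀ i : Fin (2 * n), TT n i (σ i)} := by
  have := foata (2 * n) (fun i j => i < j → Odd ((i : ℕ) + 1) ∧ Even ((j : ℕ) + 1))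
    (fun i j h h' => absurd h' h.not_gt)
  refine Eq.trans this ?_
  apply Nat.card_congr
  refine Equiv.subtypeEquivRight fun σ => forall_congr' fun i => ?_
  have := i.2
  have := (σ i).2
  rw [Nat.odd_iff, Nat.even_iff, Fin.lt_def]
  unfold TT
  omega

/-- Inner indices. -/
def innerIdx (n : ℕ) (k : Fin (2 * (n + 1))) : Prop := 0 < (k : ℕ) ∧ (k : ℕ) < 2 * n + 1

/-- Row relabelling. -/
def rowE (n : ℕ) : Fin (2 * n) ≃ Subtype (innerIdx n) where
  toFun i := ⟨⟨i + 1, by omega⟩, by constructor <;> simp⟩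
  invFun k := ⟨k.1 - 1, by have := k.2.1; have := k.2.2; omega⟩
  left_inv i := by ext; simp
  right_inv k := by
    have := k.2.1
    ext; simp; omega

/-- Column relabelling. -/
def colE (n : ℕ) : Fin (2 * n) ≃ Subtype (innerIdx n) where
  toFun j := ⟨⟨if (j : ℕ) % 2 = 1 then j / 2 + 1 else n + j / 2 + 1, by split_ifs <;> omega⟩, by
    constructor
    · simp only; split_ifs <;> omega
    · simp only; split_ifs <;> omega⟩
  invFun k := ⟨if (k.1 : ℕ) - 1 < n then 2 * (k.1 - 1) + 1 else 2 * (k.1 - 1 - n), by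
    have := k.2.1; have := k.2.2; split_ifs <;> omega⟩
  left_inv i := by
    ext; simp only; split_ifs <;> omega
  right_inv k := by
    have := k.2.1
    have := k.2.2
    ext; simp only; split_ifs <;> omega

/-- Collapsed condition for the inverse. -/
def Bd (n : ℕ) (f : Equiv.Perm (Fin (2 * (n + 1)))) : Prop :=
  ∀ k : Fin (2 * (n + 1)), ((k : ℕ) + 1) / 2 ≤ (f k : ℕ) ∧ (f k : ℕ) ≤ n + ((k : ℕ) + 1) / 2

theorem Bd_fix (n : ℕ) (f : Equiv.Perm (Fin (2 * (n + 1)))) (h : Bd n f) :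
    ∀ a, ¬ innerIdx n a → f a = a := by
  intro a ha
  have h1 := h (f.symm a)
  rw [Equiv.apply_symm_apply] at h1
  have : f.symm a = a := by
    ext
    unfold innerIdx at ha
    have := a.2
    have := (f.symm a).2
    omega
  rw [Equiv.symm_apply_eq] at this
  exact this.symm

theorem collapsed_card (n : ℕ) :
    Nat.card {π : Equiv.Perm (Fin (2 * (n + 1))) // IsCollapsed (n + 1) π} =
    Nat.card {σ : Equiv.Perm (Fin (2 * n)) // ∀ i : Fin (2 * n), TT 0 i (σ i)} := by
  classical
  have E1 : {π : Equiv.Perm (Fin (2 * (n + 1))) // IsCollapsed (n + 1) π} ≃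
      {f : Equiv.Perm (Fin (2 * (n + 1))) // Bd n f} :=
    (Equiv.inv (Equiv.Perm (Fin (2 * (n + 1))))).subtypeEquiv fun π => by
      refine forall_congr' fun k => ?_
      change _ ↔ ((k : ℕ) + 1) / 2 ≤ (π.symm k : ℕ) ∧ (π.symm k : ℕ) ≤ n + ((k : ℕ) + 1) / 2
      omega
  have E2 : {f : Equiv.Perm (Fin (2 * (n + 1))) // Bd n f} ≃
      {f : {f : Equiv.Perm (Fin (2 * (n + 1))) // ∀ a, ¬ innerIdx n a → f a = a} // Bd n f.1} :=
    (Equiv.subtypeSubtypeEquivSubtype (fun {f} h => Bd_fix n f h)).symm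
  have E3 : {σ : Equiv.Perm (Fin (2 * n)) // ∀ i : Fin (2 * n), TT 0 i (σ i)} ≃
      {f : {f : Equiv.Perm (Fin (2 * (n + 1))) // ∀ a, ¬ innerIdx n a → f a = a} // Bd n f.1} :=
    ((Equiv.equivCongr (rowE n) (colE n)).trans
      (Equiv.Perm.subtypeEquivSubtypePerm (innerIdx n))).subtypeEquiv fun σ => by
        have hin : ∀ i : Fin (2 * n), ((Equiv.Perm.ofSubtype
            (Equiv.equivCongr (rowE n) (colE n) σ) : Equiv.Perm (Fin (2 * (n + 1))))
              (rowE n i).1) = (colE n (σ i)).1 := by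
          intro i
          rw [Equiv.Perm.ofSubtype_apply_coe]
          simp
        have hout : ∀ a, ¬ innerIdx n a → ((Equiv.Perm.ofSubtype
            (Equiv.equivCongr (rowE n) (colE n) σ) : Equiv.Perm (Fin (2 * (n + 1))))
              a) = a := fun a ha => Equiv.Perm.ofSubtype_apply_of_not_mem _ ha
        change _ ↔ Bd n (Equiv.Perm.ofSubtype (Equiv.equivCongr (rowE n) (colE n) σ))
        have hi : ∀ i : Fin (2 * n), TT 0 i (σ i) ↔
            ((((rowE n i).1 : ℕ) + 1) / 2 ≤ ((colE n (σ i)).1 : ℕ) ∧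
              ((colE n (σ i)).1 : ℕ) ≤ n + (((rowE n i).1 : ℕ) + 1) / 2) := by
          intro i
          have := i.2
          have := (σ i).2
          simp only [rowE, colE, Equiv.coe_fn_mk, TT]
          split_ifs <;> omega
        constructor
        · intro H k
          by_cases hk : innerIdx n k
          · obtain ⟨i, hi'⟩ := (rowE n).surjective ⟨k, hk⟩
            have hk' : k = (rowE n i).1 := by rw [hi']
            rw [hk', hin]
            exact (hi i).1 (H i)
          · rw [hout k hk]
            unfold innerIdx at hk
            have := k.2
            omega
        · intro H i
          rw [hi, ← hin]
          exact H _
  rw [Nat.card_congr E1, Nat.card_congr E2, Nat.card_congr E3]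

/-- For all `n ≥ 1`, the number of collapsed permutations of `{1, …, 2n+2}`
equals the number of permutations in `G^I_{2n}`. -/
theorem card_collapsed_eq_card_GI (n : ℕ) (hn : 1 ≤ n) :
    Nat.card {π : Equiv.Perm (Fin (2 * (n + 1))) // IsCollapsed (n + 1) π} =
      Nat.card {π : Equiv.Perm (Fin (2 * n)) // IsGI π} := by
  rw [collapsed_card, gi_card, hybrid_all n n le_rfl]
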